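/- Let X be a galois object: a Λ-ring over K admitting an integral model and a root s_0 : X → K̄. If f : X → X is a bijective K-algebra endomorphism commuting with every ψ_𝔭 (𝔭 ∈ P_K), then there exists σ ∈ Gal(K̄/K) such that s ∘ f = σ ∘ s for every K-algebra homomorphism s : X → K̄. -/

import Mathlib

open NumberField

set_option synthInstance.maxHeartbeats 1000000
set_option maxHeartbeats 1000000

/-- The commutative monoid of nonzero ideals of a domain (under ideal multiplication). -/
def NZI (R : Type*) [CommRing R] [IsDomain R] : Submonoid (Ideal R) where
  carrier := {I | I ≠ ⊥}
  mul_mem' := by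
    intro a b ha hb h
    rcases Ideal.mul_eq_bot.mp h with h' | h'
    · exact ha h'
    · exact hb h'
  one_mem' := by
    simpa [Ideal.one_eq_top] using (top_ne_bot : (⊤ : Ideal R) ≠ ⊥)

/-- A fixed algebraic closure of `K`. -/
abbrev Kbar (K : Type*) [Field K] := AlgebraicClosure K

variable (K : Type*) [Field K] [NumberField K]
variable (X : Type*) [CommRing X] [Algebra K X]

/-- `A` is an integral model of the `Λ`-ring `(X, ψ)` over `K`: an `O_K`-subalgebra of `X`
finitely generated as an `O_K`-module, spanning `X` over `K`, stable under the `ψ_𝔭`, and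
with `ψ_𝔭(a) - a^{N𝔭} ∈ 𝔭A` for all `a ∈ A` and all nonzero primes `𝔭`. -/
def IsIntegralModel (ψ : NZI (𝓞 K) →* (X →ₐ[K] X)) (A : Subalgebra (𝓞 K) X) : Prop :=
  (Subalgebra.toSubmodule A).FG ∧
  Submodule.span K (A : Set X) = ⊤ ∧
  (∀ (p : Ideal (𝓞 K)) (_ : p.IsPrime) (hp : p ≠ ⊥), ∀ a ∈ A, ψ ⟨p, hp⟩ a ∈ A) ∧
  (∀ (p : Ideal (𝓞 K)) (_ : p.IsPrime) (hp : p ≠ ⊥), ∀ a ∈ A,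
    ψ ⟨p, hp⟩ a - a ^ Ideal.absNorm p ∈
      Submodule.span (𝓞 K) {y | ∃ r ∈ p, ∃ b ∈ A, y = r • b})


noncomputable def WW {ι : Type*} (w : ι → ENNReal) : ENNReal := ∑' e : Multiset ι, (e.map w).prod

theorem WW_le {α β : Type*} (f : α → β) (hf : Function.Injective f) (w : α → ENNReal)
    (v : β → ENNReal) (h : ∀ a, w a ≤ v (f a)) : WW w ≤ WW v := by
  unfold WW
  calc ∑' e : Multiset α, (e.map w).prod ≤ ∑' e : Multiset α, ((e.map f).map v).prod := by
        refine ENNReal.tsum_le_tsum fun e => ?_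
        rw [Multiset.map_map]
        exact Multiset.prod_map_le_prod_map₀ _ _ (fun _ _ => zero_le) (fun a _ => h a)
    _ ≤ _ := ENNReal.tsum_comp_le_tsum_of_injective (Multiset.map_injective hf)
        (fun e => (e.map v).prod)

theorem WW_sum {α β : Type*} (w : α → ENNReal) (v : β → ENNReal) :
    WW (Sum.elim w v) = WW w * WW v := by
  let F : Multiset α × Multiset β → Multiset (α ⊕ β) := fun m => m.1.map Sum.inl + m.2.map Sum.inr
  have hF : Function.Bijective F := by
    constructor
    · rintro ⟨a, b⟩ ⟨c, d⟩ h
      have h1 := congrArg (Multiset.filterMap (Sum.getLeft?)) h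
      have h2 := congrArg (Multiset.filterMap (Sum.getRight?)) h
      have e1 : ∀ (a : Multiset α) (b : Multiset β), Multiset.filterMap Sum.getLeft? (F (a, b)) = a := by
        intro a b
        induction a using Quotient.inductionOn
        induction b using Quotient.inductionOn
        simp [F, List.filterMap_map, Function.comp_def]
      have e2 : ∀ (a : Multiset α) (b : Multiset β), Multiset.filterMap Sum.getRight? (F (a, b)) = b := by
        intro a b
        induction a using Quotient.inductionOn
        induction b using Quotient.inductionOn
        simp [F, List.filterMap_map, Function.comp_def]
      rw [e1, e1] at h1
      rw [e2, e2] at h2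
      rw [h1, h2]
    · intro m
      induction m using Multiset.induction with
      | empty => exact ⟨(0, 0), by simp [F]⟩
      | cons a m ih =>
        obtain ⟨⟨x, y⟩, h⟩ := ih
        rcases a with a | b
        · exact ⟨(a ::ₘ x, y), by simp [F, ← h]⟩
        · exact ⟨(x, b ::ₘ y), by simp [F, ← h]⟩
  unfold WW
  rw [← (Equiv.ofBijective F hF).tsum_eq, ENNReal.tsum_prod', ← ENNReal.tsum_mul_right]
  refine tsum_congr fun a => ?_
  rw [← ENNReal.tsum_mul_left]
  refine tsum_congr fun b => ?_
  simp [F, Function.comp_def]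

theorem WW_unit (c : ENNReal) (hc : c ≤ 2⁻¹) : WW (fun _ : Unit => c) ≤ 2 := by
  unfold WW
  have h : ∑' e : Multiset Unit, (e.map (fun _ => c)).prod ≤ ∑' n : ℕ, c ^ n := by
    have := ENNReal.tsum_comp_le_tsum_of_injective (f := fun e : Multiset Unit => e.card) ?_
      (fun n : ℕ => c ^ n)
    · simpa using this
    · intro a b hab
      rw [Multiset.eq_replicate_card (s := a) |>.2 (fun b _ => Subsingleton.elim b ()),
        Multiset.eq_replicate_card (s := b) |>.2 (fun b _ => Subsingleton.elim b ())]
      simp only at hab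
      rw [hab]
  refine h.trans ?_
  rw [ENNReal.tsum_geometric]
  rw [ENNReal.inv_le_iff_inv_le]
  calc (2:ENNReal)⁻¹ = 1 - 2⁻¹ := by rw [ENNReal.one_sub_inv_two]
    _ ≤ 1 - c := tsub_le_tsub_left hc 1

theorem WW_finite (T : Type*) [Finite T] : ∃ C : ENNReal, C ≠ ⊤ ∧ ∀ w : T → ENNReal,
    (∀ t, w t ≤ 2⁻¹) → WW w ≤ C := by
  refine Finite.induction_empty_option (P := fun T => ∃ C : ENNReal, C ≠ ⊤ ∧ ∀ w : T → ENNReal,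
    (∀ t, w t ≤ 2⁻¹) → WW w ≤ C) ?_ ?_ ?_ T
  · rintro α β e ⟨C, hC, h⟩
    refine ⟨C, hC, fun w hw => ?_⟩
    exact (WW_le e.symm e.symm.injective w (fun a => w (e a)) (by simp)).trans (h _ (by simp [hw]))
  · refine ⟨1, by simp, fun w _ => ?_⟩
    unfold WW
    rw [tsum_eq_single 0]
    · simp
    · intro b hb; exact absurd (Subsingleton.elim b 0) hb
  · rintro α _ ⟨C, hC, h⟩
    refine ⟨C * 2, ENNReal.mul_ne_top hC (by simp), fun w hw => ?_⟩
    calc WW w ≤ WW (Sum.elim (fun a => w (some a)) (fun _ : Unit => w none)) := by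
          refine WW_le (Equiv.optionEquivSumPUnit α) (Equiv.injective _) _ _ ?_
          rintro (_ | a) <;> simp
      _ ≤ _ := by
          rw [WW_sum]
          exact mul_le_mul' (h _ (fun _ => hw _)) (WW_unit _ (hw _))

open IsDedekindDomain in
noncomputable def pw (K : Type*) [Field K] [NumberField K] (s : ℝ) (p : HeightOneSpectrum (𝓞 K)) : ENNReal :=
  (Ideal.absNorm p.asIdeal : ENNReal) ^ (-s)

noncomputable def Zid (K : Type*) [Field K] [NumberField K] (s : ℝ) : ENNReal :=
  ∑' I : {I : Ideal (𝓞 K) // I ≠ ⊥}, (Ideal.absNorm I.1 : ENNReal) ^ (-s)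

theorem abs_pos' {K : Type*} [Field K] [NumberField K] (I : Ideal (𝓞 K)) (h : I ≠ ⊥) :
    Ideal.absNorm I ≠ 0 := by
  rwa [Ne, Ideal.absNorm_eq_zero_iff]

theorem pw_prod (K : Type*) [Field K] [NumberField K] (s : ℝ)
    (m : Multiset (IsDedekindDomain.HeightOneSpectrum (𝓞 K))) :
    (m.map (pw K s)).prod =
      (Ideal.absNorm (m.map (fun p => p.asIdeal)).prod : ENNReal) ^ (-s) := by
  induction m using Multiset.induction with
  | empty => simp
  | cons a m ih =>
    simp only [Multiset.map_cons, Multiset.prod_cons, ih, map_mul, Nat.cast_mul]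
    rw [ENNReal.mul_rpow_of_ne_top (by simp) (by simp)]
    rfl

theorem prod_ne (K : Type*) [Field K] [NumberField K] 
    (m : Multiset (IsDedekindDomain.HeightOneSpectrum (𝓞 K))) :
     (m.map (fun p => p.asIdeal)).prod ≠ ⊥ := by
  induction m using Multiset.induction with
  | empty => simp
  | cons a m ih =>
    simp only [Multiset.map_cons, Multiset.prod_cons]
    intro h
    rcases Ideal.mul_eq_bot.1 h with h | h
    · exact a.ne_bot h
    · exact ih h

theorem prod_inj (K : Type*) [Field K] [NumberField K] :
    Function.Injective (fun m : Multiset (IsDedekindDomain.HeightOneSpectrum (𝓞 K)) =>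
     (⟨(m.map (fun p => p.asIdeal)).prod, prod_ne K m⟩ : {I : Ideal (𝓞 K) // I ≠ ⊥})) := by
  intro a b h
  have h := congrArg (fun I => UniqueFactorizationMonoid.normalizedFactors I.1) h
  simp only at h
  rw [UniqueFactorizationMonoid.normalizedFactors_prod_of_prime,
    UniqueFactorizationMonoid.normalizedFactors_prod_of_prime] at h
  · exact Multiset.map_injective (fun p q h => IsDedekindDomain.HeightOneSpectrum.ext h) h
  · intro p hp
    obtain ⟨q, _, rfl⟩ := Multiset.mem_map.1 hp
    exact q.prime
  · intro p hp
    obtain ⟨q, _, rfl⟩ := Multiset.mem_map.1 hp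
    exact q.prime

theorem prod_surj (K : Type*) [Field K] [NumberField K] :
    Function.Surjective (fun m : Multiset (IsDedekindDomain.HeightOneSpectrum (𝓞 K)) =>
     (⟨(m.map (fun p => p.asIdeal)).prod, prod_ne K m⟩ : {I : Ideal (𝓞 K) // I ≠ ⊥})) := by
  suffices h : ∀ I : Ideal (𝓞 K), I ≠ ⊥ → ∃ m : Multiset (IsDedekindDomain.HeightOneSpectrum (𝓞 K)),
      (m.map (fun p => p.asIdeal)).prod = I by
    rintro ⟨I, hI⟩
    obtain ⟨m, hm⟩ := h I hI
    exact ⟨m, Subtype.ext hm⟩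
  intro I
  induction I using UniqueFactorizationMonoid.induction_on_prime with
  | h₁ => intro h; exact absurd rfl h
  | h₂ x hx => intro _; exact ⟨0, by simpa [Ideal.isUnit_iff, eq_comm] using hx⟩
  | h₃ a p ha hp ih =>
    intro _
    obtain ⟨m, hm⟩ := ih ha
    exact ⟨⟨p, Ideal.isPrime_of_prime hp, hp.ne_zero⟩ ::ₘ m, by simp [hm]⟩

theorem WW_eq (K : Type*) [Field K] [NumberField K] (s : ℝ) : WW (pw K s) = Zid K s := by
  unfold WW Zid
  rw [← (Equiv.ofBijective _ ⟨prod_inj K, prod_surj K⟩).tsum_eq]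
  exact tsum_congr fun m => pw_prod K s m

theorem pw_le (K : Type*) [Field K] [NumberField K] (s : ℝ) (hs : 1 ≤ s)
    (p : IsDedekindDomain.HeightOneSpectrum (𝓞 K)) : pw K s p ≤ 2⁻¹ := by
  unfold pw
  have h2 : 2 ≤ Ideal.absNorm p.asIdeal := by
    have := abs_pos' _ p.ne_bot
    have h1 : Ideal.absNorm p.asIdeal ≠ 1 := by
      rw [Ne, Ideal.absNorm_eq_one_iff]; exact p.isPrime.ne_top
    omega
  rw [ENNReal.rpow_neg]
  refine ENNReal.inv_le_inv.2 ?_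
  calc (2 : ENNReal) ≤ (Ideal.absNorm p.asIdeal : ENNReal) := by exact_mod_cast h2
    _ = (Ideal.absNorm p.asIdeal : ENNReal) ^ (1:ℝ) := by simp
    _ ≤ _ := ENNReal.rpow_le_rpow_of_exponent_le (by exact_mod_cast (by omega)) hs

theorem Zid_eq (K : Type*) [Field K] [NumberField K] (s : ℝ) (hs : 1 < s)
    (h0 : dedekindZeta K s ≠ 0) : Zid K s = ENNReal.ofReal ‖dedekindZeta K s‖ := by
  have hsum : LSeriesSummable (fun n ↦ (Nat.card {I : Ideal (𝓞 K) // Ideal.absNorm I = n} : ℂ)) s := by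
    by_contra h
    exact h0 (tsum_eq_zero_of_not_summable h)
  set c : ℕ → ℕ := fun n => Nat.card {I : Ideal (𝓞 K) // Ideal.absNorm I = n} with hc
  let r : ℕ → ℝ := fun n => if n = 0 then 0 else (c n : ℝ) * (n : ℝ) ^ (-s)
  have hr0 : ∀ n, 0 ≤ r n := by
    intro n; simp only [r]; split_ifs <;> positivity
  have hterm : ∀ n, LSeries.term (fun n => (c n : ℂ)) s n = (r n : ℂ) := by
    intro n
    rw [LSeries.term_def]
    simp only [r]
    split_ifs with h
    · simp
    · rw [Real.rpow_neg (by positivity), div_eq_mul_inv]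
      push_cast
      rw [Complex.ofReal_cpow (by positivity)]
      simp
  have hrs : Summable r := by
    have : Summable (fun n => (r n : ℂ)) := by
      refine hsum.congr fun n => ?_
      exact hterm n
    exact_mod_cast this
  have hz : dedekindZeta K s = ((∑' n, r n : ℝ) : ℂ) := by
    unfold dedekindZeta LSeries
    rw [Complex.ofReal_tsum]
    exact tsum_congr hterm
  rw [hz, Complex.norm_real, Real.norm_of_nonneg (tsum_nonneg hr0),
    ENNReal.ofReal_tsum_of_nonneg hr0 hrs]
  unfold Zid
  rw [← (Equiv.sigmaFiberEquiv (fun I : {I : Ideal (𝓞 K) // I ≠ ⊥} => Ideal.absNorm I.1)).tsum_eq,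
    ENNReal.tsum_sigma']
  refine tsum_congr fun n => ?_
  have e1 : ∀ b : {x : {I : Ideal (𝓞 K) // I ≠ ⊥} // Ideal.absNorm x.1 = n},
    (Ideal.absNorm ((Equiv.sigmaFiberEquiv (fun I : {I : Ideal (𝓞 K) // I ≠ ⊥} => Ideal.absNorm I.1)) ⟨n, b⟩).1 : ENNReal) ^ (-s)
     = (n : ENNReal) ^ (-s) := by
    rintro ⟨b, rfl⟩
    rfl
  rw [tsum_congr e1]
  simp only [r]
  split_ifs with hn
  · subst hn
    simp only [ENNReal.ofReal_zero, ENNReal.tsum_eq_zero]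
    rintro ⟨⟨b, hb⟩, h⟩
    exact absurd h (abs_pos' b hb)
  · have hfin : Finite {I : Ideal (𝓞 K) // Ideal.absNorm I = n} :=
      (Ideal.finite_setOfPred_absNorm_eq n)
    let E : {x : {I : Ideal (𝓞 K) // I ≠ ⊥} // Ideal.absNorm x.1 = n} ≃ {I : Ideal (𝓞 K) // Ideal.absNorm I = n} :=
      { toFun := fun x => ⟨x.1.1, x.2⟩
        invFun := fun x => ⟨⟨x.1, by rintro h; exact hn (by rw [← x.2, h]; simp)⟩, x.2⟩
        left_inv := fun _ => rfl
        right_inv := fun _ => rfl }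
    rw [E.tsum_eq (fun _ => (n : ENNReal) ^ (-s)), ENNReal.tsum_const, ENNReal.ofReal_mul (by positivity),
      ENNReal.ofReal_natCast, ← ENNReal.ofReal_rpow_of_pos (by positivity), ENNReal.ofReal_natCast]
    congr 1
    rw [hc]
    simp only
    simp [ENat.card_eq_coe_natCard]

open Filter Topology in
theorem no_split (K M : Type*) [Field K] [NumberField K] [Field M] [NumberField M]
    (T : Set (IsDedekindDomain.HeightOneSpectrum (𝓞 K))) (hT : T.Finite)
    (Q : (Tᶜ : Set _) ⊕ (Tᶜ : Set _) → IsDedekindDomain.HeightOneSpectrum (𝓞 M))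
    (hQ : Function.Injective Q)
    (hN : ∀ x, Ideal.absNorm (Q x).asIdeal ≤ Ideal.absNorm (Sum.elim Subtype.val Subtype.val x).asIdeal) :
    False := by
  classical
  have : Finite T := hT
  obtain ⟨C, hC, hCb⟩ := WW_finite T
  have key : ∀ s : ℝ, 1 < s → Zid K s ^ 2 ≤ C ^ 2 * Zid M s := by
    intro s hs
    let G := WW (fun p : (Tᶜ : Set _) => pw K s p)
    have h1 : Zid K s ≤ C * G := by
      rw [← WW_eq]
      calc WW (pw K s) ≤ WW (Sum.elim (fun t : T => pw K s t) (fun p : (Tᶜ : Set _) => pw K s p)) := by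
            refine WW_le (Equiv.Set.sumCompl T).symm (Equiv.injective _) _ _ ?_
            intro a
            by_cases ha : a ∈ T
            · rw [Equiv.Set.sumCompl_symm_apply_of_mem ha]; simp
            · rw [Equiv.Set.sumCompl_symm_apply_of_notMem ha]; simp
        _ ≤ _ := by
          rw [WW_sum]
          exact mul_le_mul' (hCb _ (fun t => pw_le K s hs.le _)) le_rfl
    have h2 : G ^ 2 ≤ Zid M s := by
      rw [← WW_eq, sq, ← WW_sum]
      refine WW_le Q hQ _ _ ?_
      intro x
      have : Sum.elim (fun p : (Tᶜ : Set _) => pw K s p) (fun p : (Tᶜ : Set _) => pw K s p) x =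
        pw K s (Sum.elim Subtype.val Subtype.val x) := by rcases x with x | x <;> rfl
      rw [this]
      unfold pw
      rw [ENNReal.rpow_neg, ENNReal.rpow_neg]
      refine ENNReal.inv_le_inv.2 (ENNReal.rpow_le_rpow ?_ (by linarith))
      exact_mod_cast hN x
    calc Zid K s ^ 2 ≤ (C * G) ^ 2 := by gcongr
      _ = C ^ 2 * G ^ 2 := by ring
      _ ≤ _ := by gcongr
  have lim : ∀ (F : Type _) [Field F] [NumberField F], Tendsto (fun s : ℝ => (s - 1) * ‖dedekindZeta F s‖)
      (𝓝[>] 1) (𝓝 (dedekindZeta_residue F)) := by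
    intro F _ _
    have := (tendsto_sub_one_mul_dedekindZeta_nhdsGT F).norm
    rw [Complex.norm_real, Real.norm_of_nonneg (dedekindZeta_residue_pos F).le] at this
    refine this.congr' ?_
    filter_upwards [self_mem_nhdsWithin] with s hs
    rw [norm_mul]
    congr 1
    have : (s : ℂ) - 1 = ((s - 1 : ℝ) : ℂ) := by push_cast; rfl
    rw [this, Complex.norm_real, Real.norm_of_nonneg]
    linarith [Set.mem_Ioi.1 hs]
  have lim' : ∀ (F : Type _) [Field F] [NumberField F], Tendsto (fun s : ℝ => (s - 1) * ‖dedekindZeta F s‖)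
      (𝓝[>] 1) (𝓝 (dedekindZeta_residue F)) := by
    intro F _ _
    have := (tendsto_sub_one_mul_dedekindZeta_nhdsGT F).norm
    rw [Complex.norm_real, Real.norm_of_nonneg (dedekindZeta_residue_pos F).le] at this
    refine this.congr' ?_
    filter_upwards [self_mem_nhdsWithin] with s hs
    rw [norm_mul]
    congr 1
    have : (s : ℂ) - 1 = ((s - 1 : ℝ) : ℂ) := by push_cast; rfl
    rw [this, Complex.norm_real, Real.norm_of_nonneg]
    linarith [Set.mem_Ioi.1 hs]
  have hK := lim K
  have hM := lim' M
  have pK := dedekindZeta_residue_pos K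
  have pM := dedekindZeta_residue_pos M
  have ev : ∀ᶠ s : ℝ in 𝓝[>] 1, ((s - 1) * ‖dedekindZeta K s‖) ^ 2 ≤
      C.toReal ^ 2 * ((s - 1) * ((s - 1) * ‖dedekindZeta M s‖)) := by
    filter_upwards [self_mem_nhdsWithin, hK.eventually (lt_mem_nhds pK),
      hM.eventually (lt_mem_nhds pM)] with s hs h1 h2
    have hs := Set.mem_Ioi.1 hs
    have z1 : dedekindZeta K s ≠ 0 := by rintro h; simp [h] at h1
    have z2 : dedekindZeta M s ≠ 0 := by rintro h; simp [h] at h2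
    have := key s hs
    rw [Zid_eq K s hs z1, Zid_eq M s hs z2] at this
    have := ENNReal.toReal_mono (by finiteness) this
    simp at this
    nlinarith [mul_le_mul_of_nonneg_left this (sq_nonneg (s - 1))]
  have l1 := hK.pow 2
  have l3 : Tendsto (fun s : ℝ => s - 1) (𝓝[>] 1) (𝓝 0) := by
    have : Tendsto (fun s : ℝ => s - 1) (𝓝 1) (𝓝 (1 - 1)) := tendsto_id.sub_const 1
    rw [sub_self] at this
    exact this.mono_left nhdsWithin_le_nhds
  have l2 := (l3.mul hM).const_mul (C.toReal ^ 2)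
  have := le_of_tendsto_of_tendsto l1 l2 ev
  simp at this
  nlinarith

theorem card_le_of_pow {F : Type*} [CommRing F] [IsDomain F] (q : ℕ) (hq : 1 < q)
    (h : ∀ x : F, x ^ q = x) : Nat.card F ≤ q := by
  classical
  have hne : (Polynomial.X ^ q - Polynomial.X : Polynomial F) ≠ 0 := by
    intro h0
    have := congrArg (fun f => Polynomial.coeff f q) h0
    simp [Polynomial.coeff_X, hq.ne] at this
  have hdeg : (Polynomial.X ^ q - Polynomial.X : Polynomial F).natDegree ≤ q := by
    refine (Polynomial.natDegree_sub_le _ _).trans ?_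
    simp [hq.le]
  by_contra hlt
  push Not at hlt
  have hfin : Finite F := Nat.finite_of_card_ne_zero (by omega)
  have := Fintype.ofFinite F
  rw [Nat.card_eq_fintype_card] at hlt
  refine hne (Polynomial.eq_zero_of_natDegree_lt_card_of_eval_eq_zero _
    (f := (id : F → F)) Function.injective_id ?_ (lt_of_le_of_lt hdeg hlt))
  intro x
  simp [h x]

theorem absNorm_gt_one {K : Type*} [Field K] [NumberField K]
    (p : IsDedekindDomain.HeightOneSpectrum (𝓞 K)) : 1 < Ideal.absNorm p.asIdeal := by
  have := abs_pos' _ p.ne_bot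
  have h1 : Ideal.absNorm p.asIdeal ≠ 1 := by
    rw [Ne, Ideal.absNorm_eq_one_iff]; exact p.isPrime.ne_top
  omega

theorem norm_le_of_pow {K M : Type*} [Field K] [NumberField K] [Field M] [NumberField M]
    (p : IsDedekindDomain.HeightOneSpectrum (𝓞 K))
    (Q : IsDedekindDomain.HeightOneSpectrum (𝓞 M))
    (h : ∀ x : 𝓞 M, x ^ Ideal.absNorm p.asIdeal - x ∈ Q.asIdeal) :
    Ideal.absNorm Q.asIdeal ≤ Ideal.absNorm p.asIdeal := by
  have := Q.isPrime
  rw [Ideal.absNorm_apply Q.asIdeal, Submodule.cardQuot_apply]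
  refine card_le_of_pow (F := 𝓞 M ⧸ Q.asIdeal) _ (absNorm_gt_one p) ?_
  intro x
  obtain ⟨x, rfl⟩ := Ideal.Quotient.mk_surjective x
  rw [← map_pow, Ideal.Quotient.eq]
  exact h x

theorem residue_surj {K M : Type*} [Field K] [NumberField K] [Field M] [NumberField M] [Algebra K M]
    (p : IsDedekindDomain.HeightOneSpectrum (𝓞 K))
    (Q : IsDedekindDomain.HeightOneSpectrum (𝓞 M))
    (hc : Q.asIdeal.comap (algebraMap (𝓞 K) (𝓞 M)) = p.asIdeal)
    (h : ∀ x : 𝓞 M, x ^ Ideal.absNorm p.asIdeal - x ∈ Q.asIdeal) (x : 𝓞 M) :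
    ∃ r : 𝓞 K, x - algebraMap (𝓞 K) (𝓞 M) r ∈ Q.asIdeal := by
  have hle := norm_le_of_pow p Q h
  have : Finite (𝓞 M ⧸ Q.asIdeal) := Ideal.finiteQuotientOfFreeOfNeBot _ Q.ne_bot
  let φ : 𝓞 K ⧸ p.asIdeal →+* 𝓞 M ⧸ Q.asIdeal :=
    Ideal.quotientMap _ (algebraMap (𝓞 K) (𝓞 M)) hc.ge
  have hφ : Function.Injective φ := Ideal.quotientMap_injective' hc.le
  rw [Ideal.absNorm_apply, Ideal.absNorm_apply, Submodule.cardQuot_apply,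
    Submodule.cardQuot_apply] at hle
  have hb := hφ.bijective_of_nat_card_le hle
  obtain ⟨r, hr⟩ := hb.2 (Ideal.Quotient.mk _ x)
  obtain ⟨r, rfl⟩ := Ideal.Quotient.mk_surjective r
  refine ⟨r, ?_⟩
  rw [← Ideal.Quotient.eq, ← hr]
  simp [φ]

theorem finite_mem {L : Type*} [Field L] [NumberField L] (d : 𝓞 L) (hd : d ≠ 0) :
    {Q : IsDedekindDomain.HeightOneSpectrum (𝓞 L) | d ∈ Q.asIdeal}.Finite := by
  refine (Ideal.finite_factors (I := Ideal.span {d}) (by simpa using hd)).subset ?_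
  intro Q hQ
  simpa [Ideal.dvd_span_singleton] using hQ

theorem finite_under {K L : Type*} [Field K] [NumberField K] [Field L] [NumberField L] [Algebra K L]
    (S : Set (IsDedekindDomain.HeightOneSpectrum (𝓞 L))) (hS : S.Finite) :
    {p : IsDedekindDomain.HeightOneSpectrum (𝓞 K) | ∃ Q ∈ S,
      Q.asIdeal.comap (algebraMap (𝓞 K) (𝓞 L)) = p.asIdeal}.Finite := by
  have := (hS.image (fun Q => Q.asIdeal.comap (algebraMap (𝓞 K) (𝓞 L)))).preimage
    (f := fun p : IsDedekindDomain.HeightOneSpectrum (𝓞 K) => p.asIdeal)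
    (fun p _ q _ h => IsDedekindDomain.HeightOneSpectrum.ext h)
  refine this.subset ?_
  rintro p ⟨Q, hQ, h⟩
  exact ⟨Q, hQ, h⟩

theorem split_trivial {K M : Type*} [Field K] [NumberField K] [Field M] [NumberField M] [Algebra K M]
    (g : M ≃ₐ[K] M) (T : Set (IsDedekindDomain.HeightOneSpectrum (𝓞 K))) (hT : T.Finite)
    (h : ∀ p, p ∉ T → ∃ Q : IsDedekindDomain.HeightOneSpectrum (𝓞 M),
      Q.asIdeal.comap (algebraMap (𝓞 K) (𝓞 M)) = p.asIdeal ∧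
      ∀ x : 𝓞 M, x ^ Ideal.absNorm p.asIdeal - x ∈ Q.asIdeal) (x : M) : g x = x := by
  by_contra hx
  let γ : 𝓞 M ≃ₐ[𝓞 K] 𝓞 M := RingOfIntegers.mapAlgEquiv g
  have hγ : ∀ y : 𝓞 M, ((γ y : 𝓞 M) : M) = g y := fun y => rfl
  obtain ⟨x0, hx0⟩ : ∃ x0 : 𝓞 M, γ x0 - x0 ≠ 0 := by
    by_contra hall
    push Not at hall
    obtain ⟨a, b, hb, rfl⟩ := IsFractionRing.div_surjective (A := 𝓞 M) x
    apply hx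
    have e1 : g (algebraMap (𝓞 M) M a) = algebraMap (𝓞 M) M a := by
      have := hγ a
      rw [sub_eq_zero.1 (hall a)] at this
      exact this.symm
    have e2 : g (algebraMap (𝓞 M) M b) = algebraMap (𝓞 M) M b := by
      have := hγ b
      rw [sub_eq_zero.1 (hall b)] at this
      exact this.symm
    rw [map_div₀, e1, e2]
  have hB := finite_under (K := K) _ (finite_mem _ hx0)
  set B := {p : IsDedekindDomain.HeightOneSpectrum (𝓞 K) |
    ∃ Q ∈ {Q : IsDedekindDomain.HeightOneSpectrum (𝓞 M) | γ x0 - x0 ∈ Q.asIdeal},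
      Q.asIdeal.comap (algebraMap (𝓞 K) (𝓞 M)) = p.asIdeal} with hBdef
  have h' : ∀ p : ((T ∪ B)ᶜ : Set (IsDedekindDomain.HeightOneSpectrum (𝓞 K))),
    ∃ Q : IsDedekindDomain.HeightOneSpectrum (𝓞 M),
      Q.asIdeal.comap (algebraMap (𝓞 K) (𝓞 M)) = p.1.asIdeal ∧
      ∀ x : 𝓞 M, x ^ Ideal.absNorm p.1.asIdeal - x ∈ Q.asIdeal :=
    fun p => h p.1 (fun hp => p.2 (Or.inl hp))
  choose Q hQc hQp using h'
  let Q' : ((T ∪ B)ᶜ : Set (IsDedekindDomain.HeightOneSpectrum (𝓞 K))) →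
      IsDedekindDomain.HeightOneSpectrum (𝓞 M) := fun p =>
    ⟨(Q p).asIdeal.comap (γ : 𝓞 M →+* 𝓞 M), by
      have := (Q p).isPrime
      exact Ideal.comap_isPrime _ _, by
      intro hbot
      obtain ⟨y, hy, hy0⟩ := Submodule.exists_mem_ne_zero_of_ne_bot (Q p).ne_bot
      have : γ.symm y ∈ (Q p).asIdeal.comap (γ : 𝓞 M →+* 𝓞 M) := by
        simpa [Ideal.mem_comap] using hy
      rw [hbot] at this
      simp at this
      exact hy0 this⟩
  have hmem : ∀ p y, y ∈ (Q' p).asIdeal ↔ γ y ∈ (Q p).asIdeal := fun p y => Iff.rfl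
  have hQ'c : ∀ p, (Q' p).asIdeal.comap (algebraMap (𝓞 K) (𝓞 M)) = p.1.asIdeal := by
    intro p
    rw [← hQc p]
    ext r
    have := hmem p (algebraMap _ _ r)
    rw [AlgEquiv.commutes] at this
    exact this
  have hQ'p : ∀ p, ∀ x : 𝓞 M, x ^ Ideal.absNorm p.1.asIdeal - x ∈ (Q' p).asIdeal := by
    intro p x
    rw [hmem, map_sub, map_pow]
    exact hQp p _
  have hne : ∀ p, Q p ≠ Q' p := by
    intro p heq
    obtain ⟨r, hr⟩ := residue_surj p.1 (Q p) (hQc p) (hQp p) x0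
    have hr2 := hr
    rw [heq, hmem, map_sub, AlgEquiv.commutes] at hr2
    refine p.2 (Or.inr ⟨Q p, ?_, hQc p⟩)
    have := (Q p).asIdeal.sub_mem hr2 hr
    simpa using this
  refine no_split K M (T ∪ B) (hT.union hB) (Sum.elim Q Q') ?_ ?_
  · have hcc : ∀ {p q : ((T ∪ B)ᶜ : Set (IsDedekindDomain.HeightOneSpectrum (𝓞 K)))} 
      {P P' : IsDedekindDomain.HeightOneSpectrum (𝓞 M)}, 
        P.asIdeal.comap (algebraMap (𝓞 K) (𝓞 M)) = p.1.asIdeal →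
        P'.asIdeal.comap (algebraMap (𝓞 K) (𝓞 M)) = q.1.asIdeal → P = P' → p = q := by
      intro p q P P' h1 h2 h3
      subst h3
      exact Subtype.ext (IsDedekindDomain.HeightOneSpectrum.ext (h1.symm.trans h2))
    rintro (p | p) (q | q) hpq
    · exact congrArg _ (hcc (hQc p) (hQc q) hpq)
    · have := hcc (hQc p) (hQ'c q) hpq
      subst this
      exact absurd hpq (hne p)
    · have := hcc (hQ'c p) (hQc q) hpq
      subst this
      exact absurd hpq.symm (hne p)
    · exact congrArg _ (hcc (hQ'c p) (hQ'c q) hpq)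
  · rintro (p | p)
    · exact norm_le_of_pow _ _ (hQp p)
    · exact norm_le_of_pow _ _ (hQ'p p)

theorem phi_exists {K L X : Type*} [Field K] [NumberField K] [Field L] [NumberField L] [Algebra K L]
    [CommRing X] [Algebra K X] (A : Subalgebra (𝓞 K) X)
    (hfg : (Subalgebra.toSubmodule A).FG) (s : X →ₐ[K] L) :
    ∃ φ : A →ₐ[𝓞 K] 𝓞 L, ∀ a, (φ a : L) = s a := by
  have hint : ∀ a : A, IsIntegral ℤ (s a) := by
    intro a
    have h1 : IsIntegral (𝓞 K) (a : X) := IsIntegral.of_mem_of_fg A hfg a a.2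
    have h2 : IsIntegral (𝓞 K) (s a) := h1.map (s.restrictScalars (𝓞 K))
    exact isIntegral_trans (R := ℤ) (A := 𝓞 K) _ h2
  refine ⟨{ toFun := fun a => ⟨s a, hint a⟩
            map_one' := ?_
            map_mul' := ?_
            map_zero' := ?_
            map_add' := ?_
            commutes' := ?_ }, fun a => rfl⟩
  · ext; simp; rfl
  · intro x y; ext; simp; rfl
  · ext; simp; rfl
  · intro x y; ext; simp; rfl
  · intro r; ext
    have := (s.restrictScalars (𝓞 K)).commutes r
    exact this

noncomputable def Phi {K L X : Type*} [Field K] [NumberField K] [Field L] [NumberField L] [Algebra K L]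
    [CommRing X] [Algebra K X] (A : Subalgebra (𝓞 K) X)
    (hfg : (Subalgebra.toSubmodule A).FG) (s : X →ₐ[K] L) : A →ₐ[𝓞 K] 𝓞 L :=
  (phi_exists A hfg s).choose

theorem Phi_spec {K L X : Type*} [Field K] [NumberField K] [Field L] [NumberField L] [Algebra K L]
    [CommRing X] [Algebra K X] (A : Subalgebra (𝓞 K) X)
    (hfg : (Subalgebra.toSubmodule A).FG) (s : X →ₐ[K] L) (a : A) : (Phi A hfg s a : L) = s a :=
  (phi_exists A hfg s).choose_spec a

theorem Phi_inj {K L X : Type*} [Field K] [NumberField K] [Field L] [NumberField L] [Algebra K L]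
    [CommRing X] [Algebra K X] (A : Subalgebra (𝓞 K) X)
    (hfg : (Subalgebra.toSubmodule A).FG) (hsp : Submodule.span K (A : Set X) = ⊤)
    (s t : X →ₐ[K] L) (h : ∀ a, Phi A hfg s a = Phi A hfg t a) : s = t := by
  have : s.toLinearMap = t.toLinearMap := by
    refine LinearMap.ext_on hsp ?_
    intro a ha
    have := congrArg (fun x : 𝓞 L => (x : L)) (h ⟨a, ha⟩)
    simp only [Phi_spec] at this
    exact this
  exact AlgHom.toLinearMap_injective this

theorem span_mem {K L X : Type*} [Field K] [NumberField K] [Field L] [NumberField L] [Algebra K L]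
    [CommRing X] [Algebra K X] (A : Subalgebra (𝓞 K) X) (δ : A →ₗ[𝓞 K] 𝓞 L)
    (J P : Ideal (𝓞 L)) (p : Ideal (𝓞 K)) (hp : ∀ r ∈ p, algebraMap (𝓞 K) (𝓞 L) r ∈ P)
    (hδ : ∀ b, δ b ∈ J) (y : X)
    (hy : y ∈ Submodule.span (𝓞 K) {y | ∃ r ∈ p, ∃ b ∈ A, y = r • b}) :
    ∃ hyA : y ∈ A, δ ⟨y, hyA⟩ ∈ P * J := by
  induction hy using Submodule.span_induction with
  | mem x h =>
    obtain ⟨r, hr, b, hb, rfl⟩ := h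
    refine ⟨A.smul_mem hb r, ?_⟩
    have : (⟨r • b, A.smul_mem hb r⟩ : A) = r • (⟨b, hb⟩ : A) := rfl
    rw [this, map_smul, Algebra.smul_def]
    exact Ideal.mul_mem_mul (hp r hr) (hδ _)
  | zero => exact ⟨A.zero_mem, by
      have : (⟨0, A.zero_mem⟩ : A) = 0 := rfl
      rw [this, map_zero]; exact Ideal.zero_mem _⟩
  | add x y _ _ hx hy =>
    obtain ⟨h1, h1'⟩ := hx
    obtain ⟨h2, h2'⟩ := hy
    refine ⟨A.add_mem h1 h2, ?_⟩
    have : (⟨x + y, A.add_mem h1 h2⟩ : A) = ⟨x, h1⟩ + ⟨y, h2⟩ := rfl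
    rw [this, map_add]
    exact Ideal.add_mem _ h1' h2'
  | smul r x _ hx =>
    obtain ⟨h1, h1'⟩ := hx
    refine ⟨A.smul_mem h1 r, ?_⟩
    have : (⟨r • x, A.smul_mem h1 r⟩ : A) = r • ⟨x, h1⟩ := rfl
    rw [this, map_smul, Algebra.smul_def]
    exact Ideal.mul_mem_left _ _ h1'

theorem exists_over (K L : Type*) [Field K] [NumberField K] [Field L] [NumberField L] [Algebra K L]
    (p : IsDedekindDomain.HeightOneSpectrum (𝓞 K)) :
    ∃ P : IsDedekindDomain.HeightOneSpectrum (𝓞 L),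
      P.asIdeal.comap (algebraMap (𝓞 K) (𝓞 L)) = p.asIdeal := by
  have := p.isMaximal
  obtain ⟨Q, hQ, h⟩ := Ideal.exists_ideal_over_maximal_of_isIntegral (S := 𝓞 L) p.asIdeal (by
    rw [(RingHom.injective_iff_ker_eq_bot _).1 (FaithfulSMul.algebraMap_injective (𝓞 K) (𝓞 L))]
    exact bot_le)
  refine ⟨⟨Q, hQ.isPrime, ?_⟩, h⟩
  rintro rfl
  apply p.ne_bot
  rw [← h]
  exact Ideal.comap_bot_of_injective _ (FaithfulSMul.algebraMap_injective (𝓞 K) (𝓞 L))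

theorem exists_frob {K L : Type*} [Field K] [NumberField K] [Field L] [NumberField L] [Algebra K L]
    [IsGalois K L]
    (p : IsDedekindDomain.HeightOneSpectrum (𝓞 K)) (P : IsDedekindDomain.HeightOneSpectrum (𝓞 L))
    (h : P.asIdeal.comap (algebraMap (𝓞 K) (𝓞 L)) = p.asIdeal) :
    ∃ σ : L ≃ₐ[K] L, ∀ x : 𝓞 L, σ • x - x ^ Ideal.absNorm p.asIdeal ∈ P.asIdeal := by
  have := P.isPrime
  have : Finite (𝓞 L ⧸ P.asIdeal) := Ideal.finiteQuotientOfFreeOfNeBot _ P.ne_bot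
  obtain ⟨σ, hσ⟩ := IsArithFrobAt.exists_of_isInvariant (𝓞 K) (L ≃ₐ[K] L) P.asIdeal
  refine ⟨σ, fun x => ?_⟩
  have := hσ x
  rw [Ideal.under_def, h] at this
  rw [Ideal.absNorm_apply, Submodule.cardQuot_apply]
  exact this

/-- Frobenius congruence: `σ ∘ s ≡ s ∘ ψ_p mod P`. -/
theorem frob_cong {K L X : Type*} [Field K] [NumberField K] [Field L] [NumberField L] [Algebra K L]
    [CommRing X] [Algebra K X] (ψ : NZI (𝓞 K) →* (X →ₐ[K] X)) (A : Subalgebra (𝓞 K) X)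
    (hA : IsIntegralModel K X ψ A)
    (p : IsDedekindDomain.HeightOneSpectrum (𝓞 K)) (P : IsDedekindDomain.HeightOneSpectrum (𝓞 L))
    (h : P.asIdeal.comap (algebraMap (𝓞 K) (𝓞 L)) = p.asIdeal)
    (σ : L ≃ₐ[K] L) (hσ : ∀ x : 𝓞 L, σ • x - x ^ Ideal.absNorm p.asIdeal ∈ P.asIdeal)
    (s : X →ₐ[K] L) (a : A) :
    Phi A hA.1 (σ.toAlgHom.comp s) a - Phi A hA.1 (s.comp (ψ ⟨p.asIdeal, p.ne_bot⟩)) a ∈ P.asIdeal := by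
  obtain ⟨hyA, hy⟩ := span_mem A (Phi A hA.1 s).toLinearMap ⊤ P.asIdeal p.asIdeal
    (fun r hr => by rw [← h] at hr; exact hr) (fun _ => trivial) _
    (hA.2.2.2 p.asIdeal p.isPrime p.ne_bot a a.2)
  have hψ := hA.2.2.1 p.asIdeal p.isPrime p.ne_bot a a.2
  have e : (⟨_, hyA⟩ : A) = ⟨_, hψ⟩ - a ^ Ideal.absNorm p.asIdeal := rfl
  rw [Ideal.mul_top, e, AlgHom.toLinearMap_apply, map_sub, map_pow] at hy
  have h1 := hσ (Phi A hA.1 s a)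
  have e1 : Phi A hA.1 (σ.toAlgHom.comp s) a = σ • Phi A hA.1 s a := by
    apply RingOfIntegers.ext
    rw [Phi_spec]
    change _ = σ (Phi A hA.1 s a : L)
    rw [Phi_spec]
    rfl
  have e2 : Phi A hA.1 (s.comp (ψ ⟨p.asIdeal, p.ne_bot⟩)) a = Phi A hA.1 s ⟨_, hψ⟩ := by
    apply RingOfIntegers.ext
    rw [Phi_spec, Phi_spec]
    rfl
  rw [e1, e2]
  have := P.asIdeal.sub_mem h1 hy
  convert this using 1
  ring

/-- If `ψ_p` is onto on `A`, congruent points mod `P` are equal. -/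
theorem eq_of_cong {K L X : Type*} [Field K] [NumberField K] [Field L] [NumberField L] [Algebra K L]
    [CommRing X] [Algebra K X] (ψ : NZI (𝓞 K) →* (X →ₐ[K] X)) (A : Subalgebra (𝓞 K) X)
    (hA : IsIntegralModel K X ψ A)
    (p : IsDedekindDomain.HeightOneSpectrum (𝓞 K)) (P : IsDedekindDomain.HeightOneSpectrum (𝓞 L))
    (h : P.asIdeal.comap (algebraMap (𝓞 K) (𝓞 L)) = p.asIdeal)
    (hsurj : ∀ a ∈ A, ∃ b ∈ A, ψ ⟨p.asIdeal, p.ne_bot⟩ b = a)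
    (s t : X →ₐ[K] L) (hst : ∀ a, Phi A hA.1 s a - Phi A hA.1 t a ∈ P.asIdeal) : s = t := by
  have hpP : ∀ r ∈ p.asIdeal, algebraMap (𝓞 K) (𝓞 L) r ∈ P.asIdeal :=
    fun r hr => by rw [← h] at hr; exact hr
  have hqP : ((Ideal.absNorm p.asIdeal : ℕ) : 𝓞 L) ∈ P.asIdeal := by
    have := hpP _ (Ideal.absNorm_mem p.asIdeal)
    simpa using this
  have hq1 := absNorm_gt_one p
  have key : ∀ e : ℕ, ∀ a, Phi A hA.1 s a - Phi A hA.1 t a ∈ P.asIdeal ^ (e + 1) := by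
    intro e
    induction e with
    | zero => simpa using hst
    | succ e ih =>
      intro a
      obtain ⟨b, hb, hba⟩ := hsurj a a.2
      obtain ⟨hyA, hy⟩ := span_mem A ((Phi A hA.1 s).toLinearMap - (Phi A hA.1 t).toLinearMap)
        (P.asIdeal ^ (e + 1)) P.asIdeal p.asIdeal hpP ih _
        (hA.2.2.2 p.asIdeal p.isPrime p.ne_bot b hb)
      have e0 : (⟨_, hyA⟩ : A) = a - ⟨b, hb⟩ ^ Ideal.absNorm p.asIdeal := by
        apply Subtype.ext
        simp [hba]
      rw [e0, ← pow_succ'] at hy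
      simp only [LinearMap.sub_apply, AlgHom.toLinearMap_apply, map_sub, map_pow] at hy
      set u := Phi A hA.1 s ⟨b, hb⟩
      set v := Phi A hA.1 t ⟨b, hb⟩
      set q := Ideal.absNorm p.asIdeal
      have huv : u - v ∈ P.asIdeal ^ (e + 1) := ih _
      have hpow : u ^ q - v ^ q ∈ P.asIdeal ^ (e + 1 + 1) := by
        rw [← Commute.geom_sum₂_mul (Commute.all u v) q, pow_succ' _ (e + 1)]
        refine Ideal.mul_mem_mul ?_ huv
        have huvP : u - v ∈ P.asIdeal := hst _
        rw [← Ideal.Quotient.eq_zero_iff_mem]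
        have huv' := (Ideal.Quotient.eq).2 huvP
        rw [map_sum]
        simp only [map_mul, map_pow, huv']
        have : ∀ i ∈ Finset.range q, (Ideal.Quotient.mk P.asIdeal) v ^ i *
          (Ideal.Quotient.mk P.asIdeal) v ^ (q - 1 - i) = (Ideal.Quotient.mk P.asIdeal) v ^ (q - 1) := by
          intro i hi
          rw [← pow_add]
          congr 1
          have := Finset.mem_range.1 hi
          omega
        rw [Finset.sum_congr rfl this, Finset.sum_const, Finset.card_range, nsmul_eq_mul]
        have h0 := Ideal.Quotient.eq_zero_iff_mem.2 hqP
        rw [map_natCast] at h0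
        rw [h0, zero_mul]
      have := Ideal.add_mem _ hy hpow
      convert this using 1
      ring
  apply Phi_inj A hA.1 hA.2.1
  intro a
  have hbot := Ideal.iInf_pow_eq_bot_of_isDomain P.asIdeal P.isPrime.ne_top
  rw [← sub_eq_zero, ← Ideal.mem_bot, ← hbot]
  simp only [Ideal.mem_iInf]
  intro i
  exact Ideal.pow_le_pow_right (Nat.le_succ i) (key i a)

theorem claimB {K L X : Type*} [Field K] [NumberField K] [Field L] [NumberField L] [Algebra K L]
    [IsGalois K L]
    [CommRing X] [Algebra K X] (ψ : NZI (𝓞 K) →* (X →ₐ[K] X)) (A : Subalgebra (𝓞 K) X)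
    (hA : IsIntegralModel K X ψ A)
    (p : IsDedekindDomain.HeightOneSpectrum (𝓞 K))
    (hsurj : ∀ a ∈ A, ∃ b ∈ A, ψ ⟨p.asIdeal, p.ne_bot⟩ b = a)
    (s : X →ₐ[K] L) :
    ∃ σ : L ≃ₐ[K] L, s.comp (ψ ⟨p.asIdeal, p.ne_bot⟩) = σ.toAlgHom.comp s := by
  obtain ⟨P, hP⟩ := exists_over K L p
  obtain ⟨σ, hσ⟩ := exists_frob p P hP
  exact ⟨σ, (eq_of_cong ψ A hA p P hP hsurj _ _ (frob_cong ψ A hA p P hP σ hσ s)).symm⟩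

theorem abelian {K L X : Type*} [Field K] [NumberField K] [Field L] [NumberField L] [Algebra K L]
    [IsGalois K L]
    [CommRing X] [Algebra K X] [Module.Finite K X]
    (ψ : NZI (𝓞 K) →* (X →ₐ[K] X)) (A : Subalgebra (𝓞 K) X)
    (hA : IsIntegralModel K X ψ A) (σ τ : L ≃ₐ[K] L) (s : X →ₐ[K] L) (x : X) :
    σ (τ (s x)) = τ (σ (s x)) := by
  let H : Subgroup (L ≃ₐ[K] L) :=
    { carrier := {σ | ∀ (τ : L ≃ₐ[K] L) (s : X →ₐ[K] L) (x : X), σ (τ (s x)) = τ (σ (s x))}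
      mul_mem' := by
        intro a b ha hb τ s x
        simp only [AlgEquiv.mul_apply]
        rw [hb τ s x]
        exact ha τ (b.toAlgHom.comp s) x
      one_mem' := by intro τ s x; rfl
      inv_mem' := by
        intro a ha τ s x
        apply a.injective
        have := ha τ ((a⁻¹ : L ≃ₐ[K] L).toAlgHom.comp s) x
        change a (τ (a⁻¹ (s x))) = τ (a (a⁻¹ (s x))) at this
        rw [this, ← AlgEquiv.mul_apply a a⁻¹, ← AlgEquiv.mul_apply a a⁻¹, mul_inv_cancel]
        rfl }
  have hHmem : ∀ σ, σ ∈ H ↔ ∀ (τ : L ≃ₐ[K] L) (s : X →ₐ[K] L) (x : X), σ (τ (s x)) = τ (σ (s x)) :=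
    fun σ => Iff.rfl
  have hHn : H.Normal := by
    constructor
    intro n hn g
    rw [hHmem] at hn ⊢
    have e : ∀ (s : X →ₐ[K] L) (x : X), (g * n * g⁻¹) (s x) = n (s x) := by
      intro s x
      simp only [AlgEquiv.mul_apply]
      rw [hn g⁻¹ s x, ← AlgEquiv.mul_apply g g⁻¹, mul_inv_cancel]
      rfl
    intro τ s x
    rw [e s x]
    exact (e (τ.toAlgHom.comp s) x).trans (hn τ s x)
  suffices hσ : σ ∈ H from hσ τ s x
  have : FiniteDimensional K L := inferInstance
  let M := IntermediateField.fixedField H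
  have : IsGalois K M := IsGalois.of_fixedField_normal_subgroup H
  have : NumberField M := NumberField.of_module_finite K M
  -- bad primes
  have hbad : ∀ st : (X →ₐ[K] L) × (X →ₐ[K] L), st.1 ≠ st.2 →
    {P : IsDedekindDomain.HeightOneSpectrum (𝓞 L) |
      ∀ a, Phi A hA.1 st.1 a - Phi A hA.1 st.2 a ∈ P.asIdeal}.Finite := by
    intro st hne
    have : ∃ a, Phi A hA.1 st.1 a - Phi A hA.1 st.2 a ≠ 0 := by
      by_contra hall
      push Not at hall
      exact hne (Phi_inj A hA.1 hA.2.1 _ _ fun a => sub_eq_zero.1 (hall a))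
    obtain ⟨a, ha⟩ := this
    exact (finite_mem _ ha).subset fun P hP => hP a
  let S : Set (IsDedekindDomain.HeightOneSpectrum (𝓞 L)) :=
    ⋃ st : {st : (X →ₐ[K] L) × (X →ₐ[K] L) // st.1 ≠ st.2},
    {P | ∀ a, Phi A hA.1 st.1.1 a - Phi A hA.1 st.1.2 a ∈ P.asIdeal}
  have hS : S.Finite := Set.finite_iUnion fun st => hbad st.1 st.2
  have hfix := split_trivial (K := K) (M := M) (σ.restrictNormal M) _ (finite_under (K := K) S hS) (by
    intro p hp
    obtain ⟨P, hP⟩ := exists_over K L p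
    obtain ⟨φ, hφ⟩ := exists_frob p P hP
    have hPS : P ∉ S := fun h => hp ⟨P, h, hP⟩
    have hfrob : ∀ s : X →ₐ[K] L, φ.toAlgHom.comp s = s.comp (ψ ⟨p.asIdeal, p.ne_bot⟩) := by
      intro s
      by_contra hne
      exact hPS (Set.mem_iUnion.2 ⟨⟨(_, _), hne⟩, frob_cong ψ A hA p P hP φ hφ s⟩)
    have hφH : φ ∈ H := by
      intro τ s x
      have h1 := DFunLike.congr_fun (hfrob s) x
      have h2 := DFunLike.congr_fun (hfrob (τ.toAlgHom.comp s)) x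
      change φ (s x) = _ at h1
      change φ (τ (s x)) = τ (s _) at h2
      rw [h1, h2]
      rfl
    have hQb : P.asIdeal.comap (algebraMap (𝓞 M) (𝓞 L)) ≠ ⊥ := by
      intro hb
      apply p.ne_bot
      rw [← hP, IsScalarTower.algebraMap_eq (𝓞 K) (𝓞 M) (𝓞 L), ← Ideal.comap_comap, hb]
      exact Ideal.comap_bot_of_injective _ (FaithfulSMul.algebraMap_injective (𝓞 K) (𝓞 M))
    refine ⟨⟨P.asIdeal.comap (algebraMap (𝓞 M) (𝓞 L)), P.isPrime.comap _, hQb⟩, ?_, ?_⟩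
    · simp only
      rw [Ideal.comap_comap, ← IsScalarTower.algebraMap_eq, hP]
    · intro x
      simp only [Ideal.mem_comap]
      have h1 := hφ (algebraMap (𝓞 M) (𝓞 L) x)
      have h2 : φ • (algebraMap (𝓞 M) (𝓞 L) x) = algebraMap (𝓞 M) (𝓞 L) x := by
        apply RingOfIntegers.ext
        have := (x : M).2
        exact this ⟨φ, hφH⟩
      rw [h2] at h1
      rw [map_sub, map_pow, ← neg_sub]
      exact Ideal.neg_mem_iff _ |>.2 h1)
  rw [← IntermediateField.fixingSubgroup_fixedField H, IntermediateField.mem_fixingSubgroup_iff]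
  intro y hy
  have h1 := hfix ⟨y, hy⟩
  have h2 := AlgEquiv.restrictNormal_commutes σ M ⟨y, hy⟩
  rw [h1] at h2
  exact h2.symm

theorem exists_L (K X : Type*) [Field K] [NumberField K] [CommRing X] [Algebra K X]
    [Module.Finite K X] : ∃ L : IntermediateField K (Kbar K), FiniteDimensional K L ∧
      IsGalois K L ∧ ∀ (s : X →ₐ[K] Kbar K) (x : X), s x ∈ L := by
  classical
  let b := Module.finBasis K X
  let F : Set (Kbar K) := Set.range (fun i : (X →ₐ[K] Kbar K) × Fin (Module.finrank K X) => i.1 (b i.2))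
  have hF : F.Finite := Set.finite_range _
  let L0 := IntermediateField.adjoin K F
  have : Finite F := hF
  have h0 : FiniteDimensional K L0 :=
    IntermediateField.finiteDimensional_adjoin fun x _ => Algebra.IsIntegral.isIntegral x
  let L := IntermediateField.normalClosure K L0 (Kbar K)
  have h1 : FiniteDimensional K L := inferInstance
  have h2 : Normal K L := inferInstance
  refine ⟨L, h1, ⟨⟩, ?_⟩
  intro s x
  apply (IntermediateField.le_normalClosure L0)
  rw [← b.sum_repr x, map_sum]
  refine sum_mem fun i _ => ?_
  rw [map_smul]
  exact L0.smul_mem (IntermediateField.subset_adjoin K F ⟨(s, i), rfl⟩)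

theorem sep_points {K X : Type*} [Field K] [NumberField K] [CommRing X] [Algebra K X]
    [Module.Finite K X] [IsReduced X] (x : X) (h : ∀ s : X →ₐ[K] Kbar K, s x = 0) : x = 0 := by
  by_contra hx
  have hn : ¬ IsNilpotent x := fun hn => hx hn.eq_zero
  rw [← mem_nilradical, nilradical_eq_sInf, Submodule.mem_sInf] at hn
  push Not at hn
  obtain ⟨m', hm, hxm⟩ := hn
  obtain ⟨m, rfl⟩ : ∃ m : Ideal X, m = m' := ⟨m', rfl⟩
  have hm' : m.IsPrime := hm
  have : IsArtinianRing X := IsArtinianRing.of_finite K X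
  have : m.IsMaximal := inferInstance
  let _ : Field (X ⧸ m) := Ideal.Quotient.field m
  have : Module.Finite K (X ⧸ m) := Module.Finite.of_surjective (Ideal.Quotient.mkₐ K m).toLinearMap
    (Ideal.Quotient.mkₐ_surjective K m)
  let t : (X ⧸ m) →ₐ[K] Kbar K := IsAlgClosed.lift
  have h0 := h (t.comp (Ideal.Quotient.mkₐ K m))
  rw [AlgHom.comp_apply, map_eq_zero_iff t t.toRingHom.injective] at h0
  exact hxm (Ideal.Quotient.eq_zero_iff_mem.1 h0)

theorem fin_ord {K X : Type*} [Field K] [NumberField K] [CommRing X] [Algebra K X]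
    [Module.Finite K X] [IsReduced X] (f : X →ₐ[K] X) (hf : Function.Injective f) :
    ∃ m : ℕ, f ^ (m + 1) = 1 := by
  have hfin : Finite (X →ₐ[K] X) := by
    refine Finite.of_injective (fun (g : X →ₐ[K] X) (s : X →ₐ[K] Kbar K) => s.comp g) ?_
    intro g g' h
    ext x
    rw [← sub_eq_zero]
    apply sep_points (K := K)
    intro s
    have := DFunLike.congr_fun (congrFun h s) x
    simp only [AlgHom.comp_apply] at this
    rw [map_sub, this, sub_self]
  have hpow : ∀ k : ℕ, Function.Injective (f ^ k : X →ₐ[K] X) := by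
    intro k
    induction k with
    | zero => intro a b h; exact h
    | succ k ih => intro a b h; rw [pow_succ] at h; exact hf (ih h)
  obtain ⟨i, j, hij, h⟩ := Finite.exists_ne_map_eq_of_infinite (fun k : ℕ => f ^ k)
  have main : ∀ i j : ℕ, i < j → f ^ i = f ^ j → ∃ m : ℕ, f ^ (m + 1) = 1 := by
    intro i j hij h
    refine ⟨j - i - 1, ?_⟩
    ext x
    apply hpow i
    have e : j = i + (j - i - 1 + 1) := by omega
    have := DFunLike.congr_fun h x
    rw [e, pow_add] at this
    exact this.symm
  rcases lt_or_gt_of_ne hij with hlt | hlt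
  · exact main i j hlt h
  · exact main j i hlt h.symm

theorem comm_all {K X : Type*} [Field K] [NumberField K] [CommRing X] [Algebra K X]
    (ψ : NZI (𝓞 K) →* (X →ₐ[K] X)) (f : X →ₐ[K] X)
    (hfcomm : ∀ (p : Ideal (𝓞 K)) (_ : p.IsPrime) (hp : p ≠ ⊥),
      f.comp (ψ ⟨p, hp⟩) = (ψ ⟨p, hp⟩).comp f) (I : Ideal (𝓞 K)) (hI : I ≠ ⊥) :
    f * (ψ ⟨I, hI⟩) = (ψ ⟨I, hI⟩) * f := by
  induction I using UniqueFactorizationMonoid.induction_on_prime with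
  | h₁ => exact absurd rfl hI
  | h₂ x hx =>
    have : (⟨x, hI⟩ : NZI (𝓞 K)) = 1 := by
      apply Subtype.ext
      simpa [Ideal.isUnit_iff] using hx
    rw [this, map_one, mul_one, one_mul]
  | h₃ a p ha hp ih =>
    have e : (⟨p * a, hI⟩ : NZI (𝓞 K)) = ⟨p, hp.ne_zero⟩ * ⟨a, ha⟩ := rfl
    have h1 : f * ψ ⟨p, hp.ne_zero⟩ = ψ ⟨p, hp.ne_zero⟩ * f :=
      hfcomm p (Ideal.isPrime_of_prime hp) hp.ne_zero
    rw [e, map_mul, ← mul_assoc, h1, mul_assoc, ih ha, mul_assoc]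

theorem claim_all {K X : Type*} [Field K] [NumberField K] [CommRing X] [Algebra K X]
    (ψ : NZI (𝓞 K) →* (X →ₐ[K] X)) (Good : IsDedekindDomain.HeightOneSpectrum (𝓞 K) → Prop)
    (hG : ∀ p, Good p → ∀ s : X →ₐ[K] Kbar K, ∃ σ : Kbar K ≃ₐ[K] Kbar K, ∀ x,
      s (ψ ⟨p.asIdeal, p.ne_bot⟩ x) = σ (s x))
    (I : Ideal (𝓞 K)) (hI : I ≠ ⊥)
    (h : ∀ p : IsDedekindDomain.HeightOneSpectrum (𝓞 K), p.asIdeal ∣ I → Good p)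
    (s : X →ₐ[K] Kbar K) : ∃ σ : Kbar K ≃ₐ[K] Kbar K, ∀ x, s (ψ ⟨I, hI⟩ x) = σ (s x) := by
  induction I using UniqueFactorizationMonoid.induction_on_prime generalizing s with
  | h₁ => exact absurd rfl hI
  | h₂ x hx =>
    have : (⟨x, hI⟩ : NZI (𝓞 K)) = 1 := by
      apply Subtype.ext
      simpa [Ideal.isUnit_iff] using hx
    rw [this, map_one]
    exact ⟨1, fun x => rfl⟩
  | h₃ a p ha hp ih =>
    have e : (⟨p * a, hI⟩ : NZI (𝓞 K)) = ⟨p, hp.ne_zero⟩ * ⟨a, ha⟩ := rfl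
    obtain ⟨τ, hτ⟩ := hG ⟨p, Ideal.isPrime_of_prime hp, hp.ne_zero⟩ (h _ (dvd_mul_right p a)) s
    obtain ⟨σ, hσ⟩ := ih ha (fun q hq => h q (hq.mul_left p)) s
    refine ⟨τ * σ, fun x => ?_⟩
    rw [e, map_mul]
    exact (hτ _).trans (congrArg τ (hσ x))

/-- Let `X` be a galois object: a `Λ`-ring over `K` admitting an
integral model and a root `s₀`. If `f : X → X` is a bijective `K`-algebra endomorphism
commuting with every `ψ_𝔭`, then there is `σ ∈ Gal(K̄/K)` such that `s ∘ f = σ ∘ s` for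
every `K`-algebra homomorphism `s : X → K̄`. -/
theorem automorphism_comes_from_galois [Module.Finite K X] [IsReduced X]
    (ψ : NZI (𝓞 K) →* (X →ₐ[K] X)) (A : Subalgebra (𝓞 K) X)
    (hA : IsIntegralModel K X ψ A) (s0 : X →ₐ[K] Kbar K)
    (hroot : ∀ s : X →ₐ[K] Kbar K, ∃ (σ : Kbar K ≃ₐ[K] Kbar K) (a : NZI (𝓞 K)),
      s = (σ.toAlgHom.comp s0).comp (ψ a))
    (f : X →ₐ[K] X) (hfbij : Function.Bijective f)
    (hfcomm : ∀ (p : Ideal (𝓞 K)) (_ : p.IsPrime) (hp : p ≠ ⊥),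
      f.comp (ψ ⟨p, hp⟩) = (ψ ⟨p, hp⟩).comp f) :
    ∃ σ : Kbar K ≃ₐ[K] Kbar K, ∀ (s : X →ₐ[K] Kbar K) (x : X),
      s (f x) = σ (s x) := by
  obtain ⟨L, hL1, hL2, hL⟩ := exists_L K X
  have hLn : NumberField L := NumberField.of_module_finite K L
  let toL : (X →ₐ[K] Kbar K) → (X →ₐ[K] L) := fun s => s.codRestrict L.toSubalgebra (hL s)
  have htoL : ∀ s x, ((toL s x : L) : Kbar K) = s x := fun s x => rfl
  have hab : ∀ (σ τ : Kbar K ≃ₐ[K] Kbar K) (s : X →ₐ[K] Kbar K) (x : X),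
      σ (τ (s x)) = τ (σ (s x)) := by
    intro σ τ s x
    have h := abelian ψ A hA (σ.restrictNormal L) (τ.restrictNormal L) (toL s) x
    have h := congrArg (algebraMap L (Kbar K)) h
    rw [AlgEquiv.restrictNormal_commutes, AlgEquiv.restrictNormal_commutes,
      AlgEquiv.restrictNormal_commutes, AlgEquiv.restrictNormal_commutes] at h
    exact h
  let Good : IsDedekindDomain.HeightOneSpectrum (𝓞 K) → Prop := fun p =>
    ∀ a ∈ A, ∃ b ∈ A, ψ ⟨p.asIdeal, p.ne_bot⟩ b = a
  have hG : ∀ p, Good p → ∀ s : X →ₐ[K] Kbar K, ∃ σ : Kbar K ≃ₐ[K] Kbar K, ∀ x,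
      s (ψ ⟨p.asIdeal, p.ne_bot⟩ x) = σ (s x) := by
    intro p hp s
    obtain ⟨σ, hσ⟩ := claimB ψ A hA p hp (toL s)
    refine ⟨σ.liftNormal (Kbar K), fun x => ?_⟩
    have h := congrArg (algebraMap L (Kbar K)) (DFunLike.congr_fun hσ x)
    have h2 := AlgEquiv.liftNormal_commutes σ (Kbar K) (toL s x)
    exact h.trans h2.symm
  have hcomm : ∀ a : NZI (𝓞 K), f * ψ a = ψ a * f := fun a => comm_all ψ f hfcomm a.1 a.2
  obtain ⟨σ, a, hσa⟩ := hroot (s0.comp f)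
  have h1 : ∀ x, s0 (f x) = σ (s0 (ψ a x)) := fun x => DFunLike.congr_fun hσa x
  obtain ⟨m, hm⟩ := fin_ord f hfbij.1
  have hpow : ∀ k : ℕ, ∀ x, s0 ((f ^ k) x) = (σ ^ k) (s0 (ψ (a ^ k) x)) := by
    intro k
    induction k with
    | zero => intro x; simp
    | succ k ih =>
      intro x
      have e1 : (f ^ (k + 1)) x = (f ^ k) (f x) := by rw [pow_succ]; rfl
      have e2 : ψ (a ^ k) (f x) = f (ψ (a ^ k) x) :=
        (DFunLike.congr_fun (hcomm (a ^ k)) x).symm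
      rw [e1, ih, e2, h1, pow_succ σ, pow_succ' a, map_mul]
      rfl
  have hs0 : ∀ x, s0 x = (σ ^ (m + 1)) (s0 (ψ (a ^ (m + 1)) x)) := by
    intro x
    rw [← hpow, hm]
    rfl
  have hgood : ∀ p : IsDedekindDomain.HeightOneSpectrum (𝓞 K), p.asIdeal ∣ a.1 → Good p := by
    intro p hpa
    obtain ⟨c, hc⟩ := hpa
    have hc0 : c ≠ ⊥ := by
      rintro rfl
      apply a.2
      rw [hc, Ideal.mul_bot]
    have hac : a = ⟨c, hc0⟩ * ⟨p.asIdeal, p.ne_bot⟩ := Subtype.ext (hc.trans (mul_comm _ _))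
    have hinj : Function.Injective (ψ ⟨p.asIdeal, p.ne_bot⟩) := by
      rw [injective_iff_map_eq_zero]
      intro x hx
      apply sep_points (K := K)
      intro s
      obtain ⟨τ, b, rfl⟩ := hroot s
      have e : ψ (a ^ (m + 1)) (ψ b x) = 0 := by
        have e1 : a ^ (m + 1) * b = (a ^ m * b * ⟨c, hc0⟩) * ⟨p.asIdeal, p.ne_bot⟩ := by
          rw [pow_succ]
          nth_rewrite 2 [hac]
          ac_rfl
        have e2 : ψ (a ^ (m + 1)) (ψ b x) = ψ (a ^ (m + 1) * b) x := by rw [map_mul]; rfl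
        rw [e2, e1, map_mul]
        change ψ _ (ψ _ x) = 0
        rw [hx, map_zero]
      change τ (s0 (ψ b x)) = 0
      rw [hs0, e]
      simp
    obtain ⟨n, hn⟩ := fin_ord _ hinj
    intro y hy
    have hmem : ∀ k : ℕ, ((ψ ⟨p.asIdeal, p.ne_bot⟩) ^ k) y ∈ A := by
      intro k
      induction k with
      | zero => exact hy
      | succ k ih =>
        rw [pow_succ']
        exact hA.2.2.1 p.asIdeal p.isPrime p.ne_bot _ ih
    refine ⟨_, hmem n, ?_⟩
    rw [pow_succ'] at hn
    exact DFunLike.congr_fun hn y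
  obtain ⟨ρ, hρ⟩ := claim_all ψ Good hG a.1 a.2 hgood s0
  refine ⟨σ * ρ, fun s x => ?_⟩
  obtain ⟨τ, b, rfl⟩ := hroot s
  change τ (s0 (ψ b (f x))) = σ (ρ (τ (s0 (ψ b x))))
  have e2 : ψ b (f x) = f (ψ b x) := (DFunLike.congr_fun (hcomm b) x).symm
  have e3 : s0 (ψ a (ψ b x)) = ρ (s0 (ψ b x)) := hρ _
  rw [e2, h1, e3, hab ρ τ]
  exact hab τ σ (ρ.toAlgHom.comp s0) _
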